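/- arXiv:1004.2685 — 2 statements merged into one kernel-verified Lean document; each statement's English description precedes it below -/
import Mathlib

section
/- Let G be a finite simple graph with n vertices, let k ≥ 1, and let p be the polynomial with rational coefficients satisfying p(λ) = χ_G^k(λ) for all positive integers λ. Then for every positive integer λ, (−1)^n · p(−λ) equals the number of pairs (κ, O) where O is a k-balanced orientation of G and κ is a map from the vertices of G to {1, …, λ} satisfying κ(i) ≤ κ(j) for every directed edge (i,j) of O. -/
open Classical in
/-- Number of darts of a closed walk `c` that are oriented "forward" by the relation `r`. -/
noncomputable def fwdCount {V : Type*} {G : SimpleGraph V} {v : V}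
    (r : V → V → Prop) (c : G.Walk v v) : ℕ :=
  (c.darts.filter fun d => decide (r d.toProd.1 d.toProd.2)).length

/-- A relation `r` (directing some of the edges of `G`) is `k`-balanced if along every
cycle of `G` at least `k` edges are directed forward by `r` and at least `k` backward. -/
def KBalancedRel {V : Type*} (G : SimpleGraph V) (r : V → V → Prop) (k : ℕ) : Prop :=
  ∀ ⦃v : V⦄ (c : G.Walk v v), c.IsCycle →
    k ≤ fwdCount r c ∧ k ≤ fwdCount (fun i j => r j i) c

/-- An orientation of a simple graph `G`: for every edge `{i,j}` exactly one of
`(i,j)`, `(j,i)` is a directed edge. -/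
structure GraphOrientation {V : Type*} (G : SimpleGraph V) where
  dir : V → V → Prop
  dir_adj : ∀ ⦃i j⦄, dir i j → G.Adj i j
  exactlyOne : ∀ ⦃i j⦄, G.Adj i j → (dir i j ↔ ¬ dir j i)

/-- A `k`-balanced orientation. -/
def GraphOrientation.KBalanced {V : Type*} {G : SimpleGraph V} (O : GraphOrientation G)
    (k : ℕ) : Prop :=
  KBalancedRel G O.dir k

/-- An acyclic orientation: no directed cycles. -/
def GraphOrientation.Acyclic {V : Type*} {G : SimpleGraph V} (O : GraphOrientation G) : Prop :=
  Irreflexive (Relation.TransGen O.dir)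

/-- A proper coloring of `G` by positive integers. -/
def IsProperColoring {V : Type*} (G : SimpleGraph V) (κ : V → ℕ+) : Prop :=
  ∀ ⦃i j⦄, G.Adj i j → κ i ≠ κ j

/-- A `k`-balanced coloring: a proper coloring whose induced orientation (each edge directed
towards the larger color) is `k`-balanced. -/
def IsKBalancedColoring {V : Type*} (G : SimpleGraph V) (k : ℕ) (κ : V → ℕ+) : Prop :=
  IsProperColoring G κ ∧ KBalancedRel G (fun i j => κ i < κ j) k

/-- `χ_G^k(λ)`: the number of `k`-balanced colorings of `G` using colors from `{1,…,λ}`. -/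
noncomputable def kChromCount {V : Type*} [Fintype V] (G : SimpleGraph V) (k : ℕ)
    (lam : ℕ) : ℕ :=
  Nat.card {κ : V → ℕ+ // IsKBalancedColoring G k κ ∧ ∀ v, (κ v : ℕ) ≤ lam}

theorem antidiff_exists (q : Polynomial ℚ) :
    ∃ Q : Polynomial ℚ, ∀ x : ℚ, Q.eval (x + 1) = Q.eval x + q.eval x := by
  induction q using Polynomial.induction_on' with
  | add p q hp hq =>
    obtain ⟨P, hP⟩ := hp
    obtain ⟨Q, hQ⟩ := hq
    refine ⟨P + Q, fun x => ?_⟩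
    simp only [Polynomial.eval_add, hP, hQ]
    ring
  | monomial n a =>
    refine ⟨Polynomial.C (a / (n + 1)) * Polynomial.bernoulli (n + 1), fun x => ?_⟩
    have h := Polynomial.bernoulli_eval_one_add (n + 1) x
    have hn : (n : ℚ) + 1 ≠ 0 := by positivity
    rw [add_comm x 1, Polynomial.eval_mul, h]
    simp only [Polynomial.eval_mul, Polynomial.eval_C, Polynomial.eval_monomial]
    push_cast
    field_simp
    try simp

open Classical in
/-- maps on `U` with values in `1..m`, zero outside `U`, compatible with `r` via `s`. -/
noncomputable def ordMaps {V : Type*} [Fintype V] (s : ℕ → ℕ → Prop) (r : V → V → Prop)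
    (U : Finset V) (m : ℕ) : Finset (V → ℕ) :=
  (Fintype.piFinset fun x => if x ∈ U then Finset.Icc 1 m else {0}).filter
    fun f => ∀ x ∈ U, ∀ y ∈ U, r x y → s (f x) (f y)

theorem mem_ordMaps {V : Type*} [Fintype V] {s : ℕ → ℕ → Prop} {r : V → V → Prop}
    {U : Finset V} {m : ℕ} {f : V → ℕ} :
    f ∈ ordMaps s r U m ↔ (∀ x ∈ U, 1 ≤ f x ∧ f x ≤ m) ∧ (∀ x, x ∉ U → f x = 0) ∧
      ∀ x ∈ U, ∀ y ∈ U, r x y → s (f x) (f y) := by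
  classical
  unfold ordMaps
  rw [Finset.mem_filter, Fintype.mem_piFinset, ← and_assoc]
  refine and_congr_left fun _ => ?_
  constructor
  · intro h
    refine ⟨fun x hx => ?_, fun x hx => ?_⟩
    · have := h x
      simpa [hx] using this
    · have := h x
      simpa [hx] using this
  · rintro ⟨h1, h2⟩ x
    by_cases hx : x ∈ U
    · simpa [hx] using h1 x hx
    · simpa [hx] using h2 x hx

open Classical in
/-- maximal elements of `U`. -/
noncomputable def maxEls {V : Type*} (r : V → V → Prop) (U : Finset V) : Finset V :=
  U.filter fun x => ∀ y ∈ U, ¬ r x y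

theorem mem_maxEls {V : Type*} {r : V → V → Prop} {U : Finset V} {x : V} :
    x ∈ maxEls r U ↔ x ∈ U ∧ ∀ y ∈ U, ¬ r x y := by
  simp [maxEls]

open Classical in
/-- the inverse/forward bijection used for both counts -/
theorem card_fiber {V : Type*} [Fintype V] (s : ℕ → ℕ → Prop) (r : V → V → Prop)
    (U A : Finset V) (hA : A ⊆ maxEls r U) (m M : ℕ) (hM : 1 ≤ M) (hmM : m ≤ M)
    (hs : ∀ a, a ≤ m → s a M) (T : Finset (V → ℕ))
    (hT : ∀ f, f ∈ T ↔ f ∈ ordMaps s r U M ∧ (∀ x ∈ A, f x = M) ∧ ∀ x ∈ U \ A, f x ≤ m) :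
    T.card = (ordMaps s r (U \ A) m).card := by
  refine Finset.card_bij' (fun f _ x => if x ∈ A then 0 else f x)
    (fun g _ x => if x ∈ A then M else g x) ?_ ?_ ?_ ?_
  · intro f hf
    rw [hT, mem_ordMaps] at hf
    rw [mem_ordMaps]
    obtain ⟨⟨h1, h2, h3⟩, h4, h5⟩ := hf
    refine ⟨fun x hx => ?_, fun x hx => ?_, fun x hx y hy hxy => ?_⟩
    · have h := h5 x hx
      rw [Finset.mem_sdiff] at hx
      simp only [hx.2, if_false]
      exact ⟨(h1 x hx.1).1, h⟩
    · by_cases hxA : x ∈ A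
      · simp [hxA]
      · simp only [hxA, if_false]
        exact h2 x fun hU => hx (Finset.mem_sdiff.2 ⟨hU, hxA⟩)
    · rw [Finset.mem_sdiff] at hx hy
      simp only [hx.2, hy.2, if_false]
      exact h3 x hx.1 y hy.1 hxy
  · intro g hg
    rw [mem_ordMaps] at hg
    rw [hT, mem_ordMaps]
    obtain ⟨h1, h2, h3⟩ := hg
    refine ⟨⟨fun x hx => ?_, fun x hx => ?_, fun x hx y hy hxy => ?_⟩, fun x hx => ?_,
      fun x hx => ?_⟩
    · by_cases hxA : x ∈ A
      · simp only [hxA, if_true]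
        exact ⟨hM, le_rfl⟩
      · simp only [hxA, if_false]
        have := h1 x (Finset.mem_sdiff.2 ⟨hx, hxA⟩)
        exact ⟨this.1, this.2.trans hmM⟩
    · have hxA : x ∉ A := fun h => hx (mem_maxEls.1 (hA h)).1
      simp only [hxA, if_false]
      exact h2 x fun h => hx (Finset.mem_sdiff.1 h).1
    · have hxA : x ∉ A := fun h => (mem_maxEls.1 (hA h)).2 y hy hxy
      have hx' := Finset.mem_sdiff.2 ⟨hx, hxA⟩
      by_cases hyA : y ∈ A
      · simp only [hxA, hyA, if_false, if_true]
        exact hs _ (h1 x hx').2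
      · simp only [hxA, hyA, if_false]
        exact h3 x hx' y (Finset.mem_sdiff.2 ⟨hy, hyA⟩) hxy
    · simp [hx]
    · simp only [(Finset.mem_sdiff.1 hx).2, if_false]
      exact (h1 x hx).2
  · intro f hf
    rw [hT] at hf
    funext x
    by_cases hxA : x ∈ A
    · simp [hxA, hf.2.1 x hxA]
    · simp [hxA]
  · intro g hg
    rw [mem_ordMaps] at hg
    funext x
    by_cases hxA : x ∈ A
    · simp only [hxA, if_true]
      exact (hg.2.1 x fun h => (Finset.mem_sdiff.1 h).2 hxA).symm
    · simp [hxA]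

open Classical in
theorem strict_rec {V : Type*} [Fintype V] (r : V → V → Prop) (U : Finset V) (m : ℕ) :
    (ordMaps (· < ·) r U (m + 1)).card =
      ∑ A ∈ (maxEls r U).powerset, (ordMaps (· < ·) r (U \ A) m).card := by
  rw [Finset.card_eq_sum_card_fiberwise (f := fun f => U.filter fun x => f x = m + 1)
    (t := (maxEls r U).powerset)]
  · refine Finset.sum_congr rfl fun A hA => ?_
    rw [Finset.mem_powerset] at hA
    refine card_fiber _ r U A hA m (m + 1) (by omega) (by omega) (fun a ha => by omega) _ ?_
    intro f
    rw [Finset.mem_filter]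
    refine and_congr_right fun hf => ?_
    rw [mem_ordMaps] at hf
    constructor
    · rintro rfl
      refine ⟨fun x hx => (Finset.mem_filter.1 hx).2, fun x hx => ?_⟩
      simp only [Finset.mem_sdiff, Finset.mem_filter, not_and] at hx
      have := hx.2 hx.1
      have := (hf.1 x hx.1).2
      omega
    · rintro ⟨h1, h2⟩
      ext x
      rw [Finset.mem_filter]
      constructor
      · rintro ⟨hx, hx'⟩
        by_contra hxA
        have := h2 x (Finset.mem_sdiff.2 ⟨hx, hxA⟩)
        omega
      · intro hx
        exact ⟨(mem_maxEls.1 (hA hx)).1, h1 x hx⟩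
  · intro f hf
    rw [Finset.mem_coe, mem_ordMaps] at hf
    rw [Finset.mem_coe, Finset.mem_powerset]
    intro x hx
    rw [Finset.mem_filter] at hx
    rw [mem_maxEls]
    refine ⟨hx.1, fun y hy hxy => ?_⟩
    have h1 := hf.2.2 x hx.1 y hy hxy
    have h2 := (hf.1 y hy).2
    have h3 := hx.2
    omega

open Classical in
theorem weak_rec {V : Type*} [Fintype V] (r : V → V → Prop)
    (hr : WellFounded fun a b => r b a) (U : Finset V) (m : ℕ) :
    ((ordMaps (· ≤ ·) r U m).card : ℤ) =
      ∑ A ∈ (maxEls r U).powerset,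
        (-1 : ℤ) ^ A.card * ((ordMaps (· ≤ ·) r (U \ A) (m + 1)).card : ℤ) := by
  have key : ∀ A ∈ (maxEls r U).powerset, (ordMaps (· ≤ ·) r (U \ A) (m + 1)).card =
      ((ordMaps (· ≤ ·) r U (m + 1)).filter fun f => ∀ x ∈ A, f x = m + 1).card := by
    intro A hA
    rw [Finset.mem_powerset] at hA
    symm
    refine card_fiber _ r U A hA (m + 1) (m + 1) (by omega) le_rfl (fun a ha => ha) _ ?_
    intro f
    rw [Finset.mem_filter]
    refine and_congr_right fun hf => ?_
    rw [mem_ordMaps] at hf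
    exact ⟨fun h => ⟨h, fun x hx => (hf.1 x (Finset.mem_sdiff.1 hx).1).2⟩, fun h => h.1⟩
  have key2 : ordMaps (· ≤ ·) r U m =
      (ordMaps (· ≤ ·) r U (m + 1)).filter fun f =>
        (maxEls r U).filter (fun x => f x = m + 1) = ∅ := by
    ext f
    rw [Finset.mem_filter, Finset.filter_eq_empty_iff, mem_ordMaps, mem_ordMaps]
    constructor
    · rintro ⟨h1, h2, h3⟩
      refine ⟨⟨fun x hx => ⟨(h1 x hx).1, (h1 x hx).2.trans (by omega)⟩, h2, h3⟩, ?_⟩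
      intro x hx hx'
      have := (h1 x (mem_maxEls.1 hx).1).2
      omega
    · rintro ⟨⟨h1, h2, h3⟩, h4⟩
      refine ⟨fun x hx => ⟨(h1 x hx).1, ?_⟩, h2, h3⟩
      by_contra hlt
      have hx1 : f x = m + 1 := by have := (h1 x hx).2; omega
      obtain ⟨z, ⟨hzU, hz⟩, hmin⟩ := hr.has_min {y | y ∈ U ∧ f y = m + 1} ⟨x, hx, hx1⟩
      refine h4 (x := z) (mem_maxEls.2 ⟨hzU, fun y hy hzy => ?_⟩) hz
      refine hmin y ⟨hy, ?_⟩ hzy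
      have a := h3 z hzU y hy hzy
      have b := (h1 y hy).2
      omega
  rw [Finset.sum_congr rfl fun A hA => by rw [key A hA]]
  simp only [Finset.card_filter, Nat.cast_sum, Finset.mul_sum]
  rw [Finset.sum_comm, key2, Finset.card_filter, Nat.cast_sum]
  refine Finset.sum_congr rfl fun f _ => ?_
  have h := Finset.sum_powerset_neg_one_pow_card
    (x := (maxEls r U).filter (fun x => f x = m + 1))
  push_cast
  rw [← h]
  have : ((maxEls r U).filter (fun x => f x = m + 1)).powerset =
      (maxEls r U).powerset.filter fun A => ∀ x ∈ A, f x = m + 1 := by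
    ext A
    simp only [Finset.mem_powerset, Finset.mem_filter, Finset.subset_iff]
    exact ⟨fun h => ⟨fun x hx => (h hx).1, fun x hx => (h hx).2⟩,
      fun h x hx => ⟨h.1 hx, h.2 x hx⟩⟩
  rw [this, Finset.sum_filter]
  refine Finset.sum_congr rfl fun A _ => ?_
  split_ifs <;> simp

theorem ordMaps_empty {V : Type*} [Fintype V] (s : ℕ → ℕ → Prop) (r : V → V → Prop) (m : ℕ) :
    (ordMaps s r ∅ m).card = 1 := by
  rw [Finset.card_eq_one]
  refine ⟨fun _ => 0, ?_⟩
  ext f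
  rw [mem_ordMaps, Finset.mem_singleton]
  simp [funext_iff]

theorem ordMaps_zero {V : Type*} [Fintype V] (s : ℕ → ℕ → Prop) (r : V → V → Prop)
    (U : Finset V) (hU : U.Nonempty) : (ordMaps s r U 0).card = 0 := by
  rw [Finset.card_eq_zero, Finset.eq_empty_iff_forall_notMem]
  intro f hf
  rw [mem_ordMaps] at hf
  obtain ⟨x, hx⟩ := hU
  have := hf.1 x hx
  omega

open Classical in
theorem order_recip {V : Type*} [Fintype V] (r : V → V → Prop)
    (hr : WellFounded fun a b => r b a) (U : Finset V) :
    ∃ P : Polynomial ℚ, ∀ m : ℕ, P.eval (m : ℚ) = (ordMaps (· < ·) r U m).card ∧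
      P.eval (-(m : ℚ)) = (-1) ^ U.card * (ordMaps (· ≤ ·) r U m).card := by
  induction U using Finset.strongInduction with
  | H U ih =>
  rcases U.eq_empty_or_nonempty with rfl | hU
  · exact ⟨1, fun m => by simp [ordMaps_empty]⟩
  have ih' : ∀ A : Finset V, ∃ P : Polynomial ℚ, A ∈ (maxEls r U).powerset.erase ∅ →
      ∀ m : ℕ, P.eval (m : ℚ) = (ordMaps (· < ·) r (U \ A) m).card ∧
      P.eval (-(m : ℚ)) = (-1) ^ (U \ A).card * (ordMaps (· ≤ ·) r (U \ A) m).card := by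
    intro A
    by_cases hA : A ∈ (maxEls r U).powerset.erase ∅
    · have hA' := hA
      rw [Finset.mem_erase, Finset.mem_powerset] at hA'
      have hAU : A ⊆ U := fun x hx => (mem_maxEls.1 (hA'.2 hx)).1
      obtain ⟨P, hP⟩ := ih (U \ A) (Finset.sdiff_ssubset hAU
        (Finset.nonempty_iff_ne_empty.2 hA'.1))
      exact ⟨P, fun _ => hP⟩
    · exact ⟨0, fun h => absurd h hA⟩
  choose F hF using ih'
  obtain ⟨Q, hQ⟩ := antidiff_exists (∑ A ∈ (maxEls r U).powerset.erase ∅, F A)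
  have hmem : (∅ : Finset V) ∈ (maxEls r U).powerset := Finset.empty_mem_powerset _
  refine ⟨Q - Polynomial.C (Q.eval 0), fun m => ?_⟩
  simp only [Polynomial.eval_sub, Polynomial.eval_C]
  induction m with
  | zero => simp [ordMaps_zero _ r U hU]
  | succ m ihm =>
    obtain ⟨ih1, ih2⟩ := ihm
    constructor
    · have h := hQ m
      rw [strict_rec, ← Finset.add_sum_erase _ _ hmem]
      push_cast
      rw [h, Polynomial.eval_finsetSum, Finset.sum_congr rfl fun A hA => (hF A hA m).1]
      rw [Finset.sdiff_empty, ← ih1]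
      ring
    · have h := hQ (-((m + 1 : ℕ) : ℚ))
      have e : -((m + 1 : ℕ) : ℚ) + 1 = -(m : ℚ) := by push_cast; ring
      rw [e, Polynomial.eval_finsetSum,
        Finset.sum_congr rfl fun A hA => (hF A hA (m + 1)).2] at h
      have w := weak_rec r hr U m
      rw [← Finset.add_sum_erase _ _ hmem] at w
      have w' := congrArg (fun z : ℤ => (-1 : ℚ) ^ U.card * (z : ℚ)) w
      simp only [Finset.sdiff_empty, Finset.card_empty, pow_zero, one_mul] at w'
      push_cast at w'
      rw [mul_add, Finset.mul_sum] at w'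
      have e2 : ∀ A ∈ (maxEls r U).powerset.erase ∅,
          (-1 : ℚ) ^ U.card * ((-1) ^ A.card * ((ordMaps (· ≤ ·) r (U \ A) (m + 1)).card : ℚ)) =
          (-1) ^ (U \ A).card * ((ordMaps (· ≤ ·) r (U \ A) (m + 1)).card : ℚ) := by
        intro A hA
        rw [Finset.mem_erase, Finset.mem_powerset] at hA
        have hAU : A ⊆ U := fun x hx => (mem_maxEls.1 (hA.2 hx)).1
        rw [← Finset.card_sdiff_add_card_eq_card hAU, pow_add, ← mul_assoc,
          mul_assoc _ _ ((-1 : ℚ) ^ A.card), ← mul_pow]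
        norm_num
      rw [Finset.sum_congr rfl e2] at w'
      linarith

theorem walk_of_reflTransGen {V : Type*} {G : SimpleGraph V} (O : GraphOrientation G) {a b : V}
    (h : Relation.ReflTransGen O.dir a b) :
    ∃ w : G.Walk a b, ∀ d ∈ w.darts, O.dir d.toProd.1 d.toProd.2 := by
  induction h using Relation.ReflTransGen.head_induction_on with
  | refl => exact ⟨.nil, by simp⟩
  | head hab _ ih =>
    obtain ⟨w, hw⟩ := ih
    refine ⟨.cons (O.dir_adj hab) w, fun d hd => ?_⟩
    rw [SimpleGraph.Walk.darts_cons, List.mem_cons] at hd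
    rcases hd with rfl | hd
    · exact hab
    · exact hw d hd

theorem no_dart_back {V : Type*} {G : SimpleGraph V} {w v : V} (P : G.Walk w v) (hP : P.IsPath)
    (d : G.Dart) (hd : d ∈ P.darts) : d.toProd.2 ≠ w := by
  cases P with
  | nil => simp at hd
  | cons h p =>
    rw [SimpleGraph.Walk.cons_isPath_iff] at hP
    rw [SimpleGraph.Walk.darts_cons, List.mem_cons] at hd
    rintro rfl
    rcases hd with hd | hd
    · have := congrArg (fun d => d.toProd.2) hd
      simp only at this
      exact h.ne this
    · exact hP.2 (SimpleGraph.Walk.dart_snd_mem_support_of_mem_darts _ hd)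

theorem kbal_irrefl {V : Type*} {G : SimpleGraph V} (O : GraphOrientation G) {k : ℕ} (hk : 1 ≤ k)
    (hO : O.KBalanced k) (v : V) : ¬ Relation.TransGen O.dir v v := by
  classical
  intro h
  obtain ⟨w, hvw, hwv⟩ := Relation.TransGen.head'_iff.1 h
  obtain ⟨P, hP⟩ := walk_of_reflTransGen O hwv
  have hB : ∀ d ∈ P.bypass.darts, O.dir d.toProd.1 d.toProd.2 :=
    fun d hd => hP d (SimpleGraph.Walk.darts_bypass_subset_darts _ hd)
  have hpath := P.bypass_isPath
  generalize P.bypass = Q at hB hpath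
  have hadj := O.dir_adj hvw
  have hc : (SimpleGraph.Walk.cons hadj Q).IsCycle := by
    rw [SimpleGraph.Walk.cons_isCycle_iff]
    refine ⟨hpath, fun he => ?_⟩
    rw [SimpleGraph.Walk.edges, List.mem_map] at he
    obtain ⟨d, hd, hde⟩ := he
    have h2 := hB d hd
    have h3 := no_dart_back Q hpath d hd
    rw [SimpleGraph.Dart.edge, Sym2.eq_iff] at hde
    rcases hde with hde | hde
    · exact h3 hde.2
    · rw [hde.1, hde.2] at h2
      exact (O.exactlyOne hadj).1 hvw h2
  have := (hO _ hc).2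
  have h0 : fwdCount (fun i j => O.dir j i) (SimpleGraph.Walk.cons hadj Q) = 0 := by
    unfold fwdCount
    rw [List.length_eq_zero_iff, List.filter_eq_nil_iff]
    intro d hd
    rw [decide_eq_true_eq]
    refine (O.exactlyOne d.adj).1 ?_
    rw [SimpleGraph.Walk.darts_cons, List.mem_cons] at hd
    rcases hd with rfl | hd
    · exact hvw
    · exact hB d hd
  omega

theorem kbal_wf {V : Type*} [Fintype V] {G : SimpleGraph V} (O : GraphOrientation G) {k : ℕ}
    (hk : 1 ≤ k) (hO : O.KBalanced k) : WellFounded fun a b => O.dir b a := by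
  let R : V → V → Prop := fun a b => Relation.TransGen O.dir b a
  have : IsTrans V R := ⟨fun a b c h1 h2 => Relation.TransGen.trans h2 h1⟩
  have : Std.Irrefl R := ⟨fun a h => kbal_irrefl O hk hO a h⟩
  have h : WellFounded R := Finite.wellFounded_of_trans_of_irrefl R
  exact Subrelation.wf (fun {a b} hab => Relation.TransGen.single hab) h

/-- positive colorings as natural number valued maps -/
def mapsEquiv {V : Type*} [Fintype V] (s : ℕ → ℕ → Prop) (r : V → V → Prop) (m : ℕ) :
    {κ : V → ℕ+ // (∀ v, (κ v : ℕ) ≤ m) ∧ ∀ i j, r i j → s (κ i) (κ j)} ≃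
      {f // f ∈ ordMaps s r Finset.univ m} where
  toFun κ := ⟨fun v => (κ.1 v : ℕ), mem_ordMaps.2 ⟨fun v _ => ⟨(κ.1 v).pos, κ.2.1 v⟩,
    fun v hv => absurd (Finset.mem_univ v) hv, fun i _ j _ h => κ.2.2 i j h⟩⟩
  invFun f := ⟨fun v => ⟨f.1 v, ((mem_ordMaps.1 f.2).1 v (Finset.mem_univ v)).1⟩,
    fun v => ((mem_ordMaps.1 f.2).1 v (Finset.mem_univ v)).2,
    fun i j h => (mem_ordMaps.1 f.2).2.2 i (Finset.mem_univ i) j (Finset.mem_univ j) h⟩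
  left_inv _ := rfl
  right_inv _ := rfl

theorem card_maps {V : Type*} [Fintype V] (s : ℕ → ℕ → Prop) (r : V → V → Prop) (m : ℕ) :
    Nat.card {κ : V → ℕ+ // (∀ v, (κ v : ℕ) ≤ m) ∧ ∀ i j, r i j → s (κ i) (κ j)} =
      (ordMaps s r Finset.univ m).card := by
  rw [Nat.card_congr (mapsEquiv s r m), Nat.card_eq_fintype_card, Fintype.card_coe]

theorem finite_maps {V : Type*} [Fintype V] (s : ℕ → ℕ → Prop) (r : V → V → Prop) (m : ℕ) :
    Finite {κ : V → ℕ+ // (∀ v, (κ v : ℕ) ≤ m) ∧ ∀ i j, r i j → s (κ i) (κ j)} :=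
  Finite.of_equiv _ (mapsEquiv s r m).symm

theorem fwdCount_congr {V : Type*} {G : SimpleGraph V} {v : V} (r r' : V → V → Prop)
    (h : ∀ i j, G.Adj i j → (r i j ↔ r' i j)) (c : G.Walk v v) :
    fwdCount r c = fwdCount r' c := by
  unfold fwdCount
  congr 1
  refine List.filter_congr fun d _ => ?_
  rw [decide_eq_decide]
  exact h _ _ d.adj

theorem kbal_congr {V : Type*} {G : SimpleGraph V} (r r' : V → V → Prop) (k : ℕ)
    (h : ∀ i j, G.Adj i j → (r i j ↔ r' i j)) : KBalancedRel G r k ↔ KBalancedRel G r' k := by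
  unfold KBalancedRel
  refine forall_congr' fun v => forall_congr' fun c => ?_
  rw [fwdCount_congr r r' h c,
    fwdCount_congr (fun i j => r j i) (fun i j => r' j i) (fun i j hij => h j i hij.symm) c]

theorem dir_ext {V : Type*} {G : SimpleGraph V} {O O' : GraphOrientation G}
    (h : O.dir = O'.dir) : O = O' := by
  cases O
  cases O'
  simp only at h
  subst h
  rfl

theorem dir_iff {V : Type*} {G : SimpleGraph V} (O : GraphOrientation G) (κ : V → ℕ+)
    (h : ∀ i j, O.dir i j → (κ i : ℕ) < κ j) {i j : V} (hij : G.Adj i j) :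
    O.dir i j ↔ κ i < κ j := by
  refine ⟨fun hd => PNat.coe_lt_coe _ _ |>.1 (h i j hd), fun hlt => ?_⟩
  by_contra hd
  have h2 : O.dir j i := by
    by_contra h2
    exact hd ((O.exactlyOne hij).2 h2)
  have h3 := h j i h2
  rw [PNat.coe_lt_coe] at h3
  exact absurd hlt (not_lt.2 h3.le)

/-- the orientation induced by a proper coloring -/
def inducedOr {V : Type*} {G : SimpleGraph V} (κ : V → ℕ+) (h : IsProperColoring G κ) :
    GraphOrientation G where
  dir i j := G.Adj i j ∧ κ i < κ j
  dir_adj _ _ h := h.1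
  exactlyOne i j hij := by
    have := h hij
    constructor
    · rintro ⟨_, h1⟩ ⟨_, h2⟩
      exact absurd h1 (not_lt.2 h2.le)
    · intro h2
      refine ⟨hij, lt_of_le_of_ne ?_ this⟩
      by_contra h3
      exact h2 ⟨hij.symm, not_le.1 h3⟩

/-- colorings fibered over orientations -/
def chromEquiv {V : Type*} (G : SimpleGraph V) (k m : ℕ) :
    {κ : V → ℕ+ // IsKBalancedColoring G k κ ∧ ∀ v, (κ v : ℕ) ≤ m} ≃
      Σ O : {O : GraphOrientation G // O.KBalanced k},
        {κ : V → ℕ+ // (∀ v, (κ v : ℕ) ≤ m) ∧ ∀ i j, O.1.dir i j → (κ i : ℕ) < κ j} where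
  toFun κ := ⟨⟨inducedOr κ.1 κ.2.1.1, (kbal_congr _ _ k fun i j hij =>
      ⟨fun h => h.2, fun h => ⟨hij, h⟩⟩).2 κ.2.1.2⟩,
    ⟨κ.1, κ.2.2, fun i j h => (PNat.coe_lt_coe _ _).2 h.2⟩⟩
  invFun q := ⟨q.2.1, ⟨fun i j hij he => by
      have h1 : ¬ q.1.1.dir i j := fun h => by
        have := q.2.2.2 i j h
        rw [he] at this
        exact lt_irrefl _ this
      have h2 : ¬ q.1.1.dir j i := fun h => by
        have := q.2.2.2 j i h
        rw [he] at this
        exact lt_irrefl _ this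
      exact h1 ((q.1.1.exactlyOne hij).2 h2),
    (kbal_congr _ _ k fun i j hij => dir_iff q.1.1 q.2.1 q.2.2.2 hij).1 q.1.2⟩, q.2.2.1⟩
  left_inv _ := rfl
  right_inv := by
    rintro ⟨⟨O, hO⟩, ⟨κ, h1, h2⟩⟩
    have hd : ∀ h, inducedOr (G := G) κ h = O := by
      intro h
      refine dir_ext ?_
      funext i j
      refine propext ⟨fun hh => (dir_iff O κ h2 hh.1).2 hh.2, fun hh => ?_⟩
      exact ⟨O.dir_adj hh, (dir_iff O κ h2 (O.dir_adj hh)).1 hh⟩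
    have key : ∀ (O' : GraphOrientation G) (hO' : O'.KBalanced k)
        (h2' : ∀ i j, O'.dir i j → (κ i : ℕ) < κ j), O' = O →
        (⟨⟨O', hO'⟩, ⟨κ, h1, h2'⟩⟩ : Σ O : {O : GraphOrientation G // O.KBalanced k},
        {κ : V → ℕ+ // (∀ v, (κ v : ℕ) ≤ m) ∧ ∀ i j, O.1.dir i j → (κ i : ℕ) < κ j}) =
        ⟨⟨O, hO⟩, ⟨κ, h1, h2⟩⟩ := by
      rintro O' hO' h2' rfl
      rfl
    refine key _ _ ?_ (hd _)
    exact fun i j h => (PNat.coe_lt_coe _ _).2 h.2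

/-- pairs fibered over orientations -/
def pairEquiv {V : Type*} (G : SimpleGraph V) (k m : ℕ) :
    {q : GraphOrientation G × (V → ℕ+) //
        q.1.KBalanced k ∧ (∀ v, (q.2 v : ℕ) ≤ m) ∧
        ∀ i j : V, q.1.dir i j → q.2 i ≤ q.2 j} ≃
      Σ O : {O : GraphOrientation G // O.KBalanced k},
        {κ : V → ℕ+ // (∀ v, (κ v : ℕ) ≤ m) ∧ ∀ i j, O.1.dir i j → (κ i : ℕ) ≤ κ j} where
  toFun q := ⟨⟨q.1.1, q.2.1⟩, ⟨q.1.2, q.2.2.1, fun i j h => (PNat.coe_le_coe _ _).2 (q.2.2.2 i j h)⟩⟩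
  invFun q := ⟨(q.1.1, q.2.1), q.1.2, q.2.2.1, fun i j h => (PNat.coe_le_coe _ _).1 (q.2.2.2 i j h)⟩
  left_inv _ := rfl
  right_inv _ := rfl

/-- (Reciprocity.) Let `G` have `n` vertices, `k ≥ 1`, and let `p` be the
polynomial with `p(λ) = χ_G^k(λ)` for all positive integers `λ`.  Then for every positive
integer `λ`, `(−1)^n · p(−λ)` is the number of pairs `(O, κ)` where `O` is a `k`-balanced
orientation of `G` and `κ : V → {1,…,λ}` satisfies `κ(i) ≤ κ(j)` for every directed edge
`(i,j)` of `O`. -/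
theorem stmt14 {V : Type*} [Fintype V] (G : SimpleGraph V) (k : ℕ) (hk : 1 ≤ k)
    (p : Polynomial ℚ)
    (hp : ∀ lam : ℕ, 0 < lam → p.eval (lam : ℚ) = kChromCount G k lam)
    (lam : ℕ) (hlam : 0 < lam) :
    (-1 : ℚ) ^ (Fintype.card V) * p.eval (-(lam : ℚ)) =
      Nat.card {q : GraphOrientation G × (V → ℕ+) //
        q.1.KBalanced k ∧ (∀ v, (q.2 v : ℕ) ≤ lam) ∧
        ∀ i j : V, q.1.dir i j → q.2 i ≤ q.2 j} := by
  classical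
  have : Finite (GraphOrientation G) :=
    Finite.of_injective (fun O : GraphOrientation G => O.dir) fun O O' h => dir_ext h
  let _ : Fintype {O : GraphOrientation G // O.KBalanced k} := Fintype.ofFinite _
  have hS : ∀ m, kChromCount G k m = ∑ O : {O : GraphOrientation G // O.KBalanced k},
      (ordMaps (· < ·) O.1.dir Finset.univ m).card := by
    intro m
    have := fun O : {O : GraphOrientation G // O.KBalanced k} =>
      finite_maps (· < ·) O.1.dir m
    unfold kChromCount
    rw [Nat.card_congr (chromEquiv G k m), Nat.card_sigma]
    exact Finset.sum_congr rfl fun O _ => card_maps (· < ·) O.1.dir m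
  have hW : Nat.card {q : GraphOrientation G × (V → ℕ+) //
        q.1.KBalanced k ∧ (∀ v, (q.2 v : ℕ) ≤ lam) ∧
        ∀ i j : V, q.1.dir i j → q.2 i ≤ q.2 j} =
      ∑ O : {O : GraphOrientation G // O.KBalanced k},
      (ordMaps (· ≤ ·) O.1.dir Finset.univ lam).card := by
    have := fun O : {O : GraphOrientation G // O.KBalanced k} =>
      finite_maps (· ≤ ·) O.1.dir lam
    rw [Nat.card_congr (pairEquiv G k lam), Nat.card_sigma]
    exact Finset.sum_congr rfl fun O _ => card_maps (· ≤ ·) O.1.dir lam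
  choose P hP using fun O : {O : GraphOrientation G // O.KBalanced k} =>
    order_recip O.1.dir (kbal_wf O.1 hk O.2) Finset.univ
  have hpP : p = ∑ O, P O := by
    refine Polynomial.eq_of_infinite_eval_eq _ _ ?_
    refine Set.Infinite.mono ?_ (Set.infinite_range_of_injective
      (f := fun m : ℕ => ((m + 1 : ℕ) : ℚ)) fun a b h => by
        have h' : ((a + 1 : ℕ) : ℚ) = ((b + 1 : ℕ) : ℚ) := h
        have := Nat.cast_injective h'
        omega)
    rintro _ ⟨m, rfl⟩
    rw [Set.mem_ofPred_eq, hp (m + 1) (Nat.succ_pos m), hS, Polynomial.eval_finsetSum]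
    push_cast
    refine Finset.sum_congr rfl fun O _ => ?_
    have := (hP O (m + 1)).1
    push_cast at this
    exact this.symm
  rw [hW, hpP, Polynomial.eval_finsetSum, Finset.mul_sum, Nat.cast_sum]
  refine Finset.sum_congr rfl fun O _ => ?_
  rw [(hP O lam).2, Finset.card_univ, ← mul_assoc, ← mul_pow]
  norm_num
end

section
/- Let G be a finite simple graph, let k ≥ 1, and let λ be a positive integer. Then the number of k-balanced colorings of G using colors from {1, …, λ} equals the sum, over all k-balanced orientations O of G, of the number of strictly order-preserving maps from the induced poset P_O to {1, …, λ} (i.e., χ_G^k(λ) = Σ_O Ω̄(P_O, λ), where Ω̄ denotes the strict order polynomial). -/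
theorem fwdCount_congr_aux {V : Type*} {G : SimpleGraph V} {r s : V → V → Prop}
    (h : ∀ i j, G.Adj i j → (r i j ↔ s i j)) {v : V} (c : G.Walk v v) :
    fwdCount r c = fwdCount s c := by
  unfold fwdCount
  congr 1
  apply List.filter_congr
  intro d _
  simp [h _ _ d.adj]

theorem kBalancedRel_congr_aux {V : Type*} {G : SimpleGraph V} {r s : V → V → Prop} {k : ℕ}
    (h : ∀ i j, G.Adj i j → (r i j ↔ s i j)) :
    KBalancedRel G r k ↔ KBalancedRel G s k := by
  unfold KBalancedRel
  have h1 : ∀ {v : V} (c : G.Walk v v), fwdCount r c = fwdCount s c := fun c =>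
    fwdCount_congr_aux h c
  have h2 : ∀ {v : V} (c : G.Walk v v),
      fwdCount (fun i j => r j i) c = fwdCount (fun i j => s j i) c := fun c =>
    fwdCount_congr_aux (fun i j hij => h j i hij.symm) c
  simp only [h1, h2]

/-- orientation induced by a proper coloring -/
def orientOf {V : Type*} {G : SimpleGraph V} (κ : V → ℕ+) (h : IsProperColoring G κ) :
    GraphOrientation G where
  dir i j := G.Adj i j ∧ κ i < κ j
  dir_adj _ _ h := h.1
  exactlyOne i j hij := by
    have := h hij
    simp only [hij, hij.symm, true_and, not_lt]
    exact ⟨le_of_lt, fun h' => lt_of_le_of_ne h' this⟩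

theorem dir_iff_aux {V : Type*} {G : SimpleGraph V} (O : GraphOrientation G) (κ : V → ℕ+)
    (h : ∀ i j : V, Relation.TransGen O.dir i j → κ i < κ j) (i j : V) (hij : G.Adj i j) :
    O.dir i j ↔ κ i < κ j := by
  refine ⟨fun hd => h i j (.single hd), fun hlt => ?_⟩
  rw [O.exactlyOne hij]
  exact fun hd => lt_asymm hlt (h j i (.single hd))

theorem orientation_ext_aux {V : Type*} {G : SimpleGraph V} {O P : GraphOrientation G}
    (h : ∀ i j, O.dir i j ↔ P.dir i j) : O = P := by
  cases O; cases P
  congr 1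
  funext i j
  exact propext (h i j)

/-- For every positive integer `λ`, the number of `k`-balanced colorings of
`G` with colors in `{1,…,λ}` equals the sum, over all `k`-balanced orientations `O` of `G`,
of the number of strictly order-preserving maps from the induced poset `P_O` (strict order:
transitive closure of the edge relation of `O`) to `{1,…,λ}`; i.e.
`χ_G^k(λ) = Σ_O Ω̄(P_O, λ)`, realized here as a count of pairs `(O, τ)`. -/
theorem stmt16 {V : Type*} [Fintype V] (G : SimpleGraph V) (k : ℕ) (hk : 1 ≤ k)
    (lam : ℕ) (hlam : 0 < lam) :
    kChromCount G k lam =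
      Nat.card {q : GraphOrientation G × (V → ℕ+) //
        q.1.KBalanced k ∧ (∀ v, (q.2 v : ℕ) ≤ lam) ∧
        ∀ i j : V, Relation.TransGen q.1.dir i j → q.2 i < q.2 j} := by
  unfold kChromCount
  apply Nat.card_congr
  refine
    { toFun := fun κ => ⟨(orientOf κ.1 κ.2.1.1, κ.1), ?_, κ.2.2, ?_⟩
      invFun := fun q => ⟨q.1.2, ⟨?_, ?_⟩, q.2.2.1⟩
      left_inv := ?_
      right_inv := ?_ }
  · exact (kBalancedRel_congr_aux (fun i j hij => by simp [orientOf, hij])).2 κ.2.1.2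
  · intro i j hij
    induction hij with
    | single h => exact h.2
    | tail _ h ih => exact lt_trans ih h.2
  · intro i j hij heq
    have h1 := dir_iff_aux q.1.1 q.1.2 q.2.2.2 i j hij
    have h2 := dir_iff_aux q.1.1 q.1.2 q.2.2.2 j i hij.symm
    have h3 := q.1.1.exactlyOne hij
    rw [h1, h2, heq] at h3
    simp at h3
  · exact (kBalancedRel_congr_aux (dir_iff_aux q.1.1 q.1.2 q.2.2.2)).1 q.2.1
  · intro κ
    rfl
  · rintro ⟨⟨O, κ⟩, h1, h2, h3⟩
    apply Subtype.ext
    refine Prod.ext (orientation_ext_aux fun i j => ?_) rfl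
    refine ⟨fun h => (dir_iff_aux O κ h3 i j h.1).2 h.2, fun h => ⟨O.dir_adj h, ?_⟩⟩
    exact h3 i j (.single h)
end
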